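/- Suppose g(u) = b for all u (so f' = ε with ε = ±1 and f(u) = εu + a) and the spherical curvature κ is a non-zero constant κ₀. Then ΔG = ((κ₀² + 1)/f²)(G + C), where C = −(1/(κ₀² + 1)) x∧y − (κ₀ ε/(κ₀² + 1)) y∧n₁ is a nonzero bivector that is constant in (u,v). In particular M² has proper pointwise 1-type Gauss map of the second kind. -/

import Mathlib

open Matrix

noncomputable section

/-- The embedding of `ℝ³ = span{e₁,e₂,e₃}` into `ℝ⁴`. -/
def emb (p : Fin 3 → ℝ) : Fin 4 → ℝ := ![p 0, p 1, p 2, 0]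

/-- The fourth standard basis vector `e₄` of `ℝ⁴`. -/
def e4 : Fin 4 → ℝ := ![0, 0, 0, 1]

/-- Model of the bivector `a ∧ b ∈ Λ²ℝ⁴` as the antisymmetric matrix `aᵢbⱼ − aⱼbᵢ`. -/
def wedge (a b : Fin 4 → ℝ) : Fin 4 → Fin 4 → ℝ := fun i j => a i * b j - a j * b i

/-- The tangent `t = r'` of the spherical curve `r`. -/
def sphT (r : ℝ → Fin 3 → ℝ) : ℝ → Fin 3 → ℝ := deriv r

/-- The normal `n = r × t` of the spherical curve `r`. -/
def sphN (r : ℝ → Fin 3 → ℝ) (v : ℝ) : Fin 3 → ℝ := crossProduct (r v) (deriv r v)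

/-- The spherical curvature `κ = ⟨t', n⟩` of the spherical curve `r`. -/
def sphCurv (r : ℝ → Fin 3 → ℝ) (v : ℝ) : ℝ := deriv (deriv r) v ⬝ᵥ sphN r v

/-- The curvature `κ_α = f′g″ − g′f″` of the meridian curve `α = (f, g)`. -/
def merCurv (f g : ℝ → ℝ) (u : ℝ) : ℝ :=
  deriv f u * deriv (deriv g) u - deriv g u * deriv (deriv f) u

/-- The parametrization `z(u,v) = f(u) r(v) + g(u) e₄` of the meridian surface `M²`. -/
def mz (f g : ℝ → ℝ) (r : ℝ → Fin 3 → ℝ) (u v : ℝ) : Fin 4 → ℝ :=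
  f u • emb (r v) + g u • e4

/-- The tangent frame vector `x = ∂z/∂u = f′ r + g′ e₄`. -/
def mx (f g : ℝ → ℝ) (r : ℝ → Fin 3 → ℝ) (u v : ℝ) : Fin 4 → ℝ :=
  deriv f u • emb (r v) + deriv g u • e4

/-- The tangent frame vector `y = (1/f) ∂z/∂v = t`. -/
def my (r : ℝ → Fin 3 → ℝ) (v : ℝ) : Fin 4 → ℝ := emb (deriv r v)

/-- The normal frame vector `n₁ = n`. -/
def mn1 (r : ℝ → Fin 3 → ℝ) (v : ℝ) : Fin 4 → ℝ := emb (sphN r v)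

/-- The normal frame vector `n₂ = −g′ r + f′ e₄`. -/
def mn2 (f g : ℝ → ℝ) (r : ℝ → Fin 3 → ℝ) (u v : ℝ) : Fin 4 → ℝ :=
  (-(deriv g u)) • emb (r v) + deriv f u • e4

/-- The Gauss map `G = x ∧ y` of the meridian surface, with values in `Λ²ℝ⁴`. -/
def gaussG (f g : ℝ → ℝ) (r : ℝ → Fin 3 → ℝ) (u v : ℝ) : Fin 4 → Fin 4 → ℝ :=
  wedge (mx f g r u v) (my r v)

/-- The Laplacian `Δφ = −(∂²φ/∂u² + (1/f²) ∂²φ/∂v² + (f′/f) ∂φ/∂u)` of the meridian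
surface, acting on `Λ²ℝ⁴`-valued functions. -/
def surfLap (f : ℝ → ℝ) (φ : ℝ → ℝ → Fin 4 → Fin 4 → ℝ) (u v : ℝ) : Fin 4 → Fin 4 → ℝ :=
  -(deriv (deriv (fun s => φ s v)) u + (1 / f u ^ 2) • deriv (deriv (fun s => φ u s)) v
    + (deriv f u / f u) • deriv (fun s => φ s v) u)

/-- `h(x,x)`: the normal component (w.r.t. `{n₁, n₂}`) of `∇′ₓx = ∂x/∂u`. -/
def hxx (f g : ℝ → ℝ) (r : ℝ → Fin 3 → ℝ) (u v : ℝ) : Fin 4 → ℝ :=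
  (deriv (fun s => mx f g r s v) u ⬝ᵥ mn1 r v) • mn1 r v
    + (deriv (fun s => mx f g r s v) u ⬝ᵥ mn2 f g r u v) • mn2 f g r u v

/-- `h(x,y)`: the normal component (w.r.t. `{n₁, n₂}`) of `∇′_y x = (1/f) ∂x/∂v`. -/
def hxy (f g : ℝ → ℝ) (r : ℝ → Fin 3 → ℝ) (u v : ℝ) : Fin 4 → ℝ :=
  (((1 / f u) • deriv (fun s => mx f g r u s) v) ⬝ᵥ mn1 r v) • mn1 r v
    + (((1 / f u) • deriv (fun s => mx f g r u s) v) ⬝ᵥ mn2 f g r u v) • mn2 f g r u v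

/-- `h(y,y)`: the normal component (w.r.t. `{n₁, n₂}`) of `∇′_y y = (1/f) ∂y/∂v`. -/
def hyy (f g : ℝ → ℝ) (r : ℝ → Fin 3 → ℝ) (u v : ℝ) : Fin 4 → ℝ :=
  (((1 / f u) • deriv (my r) v) ⬝ᵥ mn1 r v) • mn1 r v
    + (((1 / f u) • deriv (my r) v) ⬝ᵥ mn2 f g r u v) • mn2 f g r u v


/-- The constant bivector `C = −(1/(κ₀²+1)) x∧y − (κ₀ε/(κ₀²+1)) y∧n₁` of Statement 11. -/
def C11 (f g : ℝ → ℝ) (r : ℝ → Fin 3 → ℝ) (κ₀ ε : ℝ) (u v : ℝ) : Fin 4 → Fin 4 → ℝ :=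
  (-(1 / (κ₀ ^ 2 + 1))) • wedge (mx f g r u v) (my r v)
    + (-(κ₀ * ε / (κ₀ ^ 2 + 1))) • wedge (my r v) (mn1 r v)

theorem hasDerivAt_emb {p : ℝ → Fin 3 → ℝ} {p' : Fin 3 → ℝ} {v : ℝ} (hp : HasDerivAt p p' v) :
    HasDerivAt (fun s => emb (p s)) (emb p') v := by
  rw [hasDerivAt_pi] at hp ⊢
  intro i
  fin_cases i
  · exact hp 0
  · exact hp 1
  · exact hp 2
  · exact hasDerivAt_const v (0 : ℝ)

theorem hasDerivAt_wedge {p q : ℝ → Fin 4 → ℝ} {p' q' : Fin 4 → ℝ} {v : ℝ}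
    (hp : HasDerivAt p p' v) (hq : HasDerivAt q q' v) :
    HasDerivAt (fun s => wedge (p s) (q s)) (wedge p' (q v) + wedge (p v) q') v := by
  rw [hasDerivAt_pi] at hp hq
  rw [hasDerivAt_pi]
  intro i
  rw [hasDerivAt_pi]
  intro j
  refine (((hp i).mul (hq j)).sub ((hp j).mul (hq i))).congr_deriv ?_
  simp only [wedge, Pi.add_apply]
  ring

theorem hasDerivAt_crossProduct {p q : ℝ → Fin 3 → ℝ} {p' q' : Fin 3 → ℝ} {v : ℝ}
    (hp : HasDerivAt p p' v) (hq : HasDerivAt q q' v) :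
    HasDerivAt (fun s => crossProduct (p s) (q s))
      (crossProduct p' (q v) + crossProduct (p v) q') v := by
  rw [hasDerivAt_pi] at hp hq
  rw [hasDerivAt_pi]
  intro i
  fin_cases i
  · refine (((hp 1).mul (hq 2)).sub ((hp 2).mul (hq 1))).congr_deriv ?_
    simp [cross_apply]
    ring
  · refine (((hp 2).mul (hq 0)).sub ((hp 0).mul (hq 2))).congr_deriv ?_
    simp [cross_apply]
    ring
  · refine (((hp 0).mul (hq 1)).sub ((hp 1).mul (hq 0))).congr_deriv ?_
    simp [cross_apply]
    ring

theorem hasDerivAt_dotProduct {p q : ℝ → Fin 3 → ℝ} {p' q' : Fin 3 → ℝ} {v : ℝ}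
    (hp : HasDerivAt p p' v) (hq : HasDerivAt q q' v) :
    HasDerivAt (fun s => p s ⬝ᵥ q s) (p' ⬝ᵥ q v + p v ⬝ᵥ q') v := by
  rw [hasDerivAt_pi] at hp hq
  simp only [dotProduct, ← Finset.sum_add_distrib]
  exact HasDerivAt.fun_sum fun i _ => (hp i).mul (hq i)

theorem eq_sum_dotProduct_smul_of_orthonormal {a b w : Fin 3 → ℝ} (haa : a ⬝ᵥ a = 1)
    (hbb : b ⬝ᵥ b = 1) (hab : a ⬝ᵥ b = 0) :
    w = (w ⬝ᵥ a) • a + (w ⬝ᵥ b) • b + (w ⬝ᵥ crossProduct a b) • crossProduct a b := by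
  set n := crossProduct a b with hn
  have hnn : n ⬝ᵥ n = 1 := by
    rw [hn, cross_dot_cross, haa, hbb, hab, dotProduct_comm b a, hab]; norm_num
  have han : a ⬝ᵥ n = 0 := dot_self_cross a b
  have hbn : b ⬝ᵥ n = 0 := dot_cross_self a b
  have hM : Matrix.of ![a, b, n] * (Matrix.of ![a, b, n])ᵀ = 1 := by
    ext i j
    change ![a, b, n] i ⬝ᵥ ![a, b, n] j = _
    fin_cases i <;> fin_cases j <;>
      simp [haa, hbb, hab, hnn, han, hbn, dotProduct_comm b a, dotProduct_comm n]
  have hM' := mul_eq_one_comm.mp hM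
  have h := congrArg (fun A => w ᵥ* A) hM'
  simp only [vecMul_one] at h
  refine h.symm.trans ?_
  ext i
  simp [vecMul, Matrix.mul_apply, dotProduct, Fin.sum_univ_three]
  ring

theorem cross_frenet {a b : Fin 3 → ℝ} (haa : a ⬝ᵥ a = 1) (hab : a ⬝ᵥ b = 0) :
    crossProduct a (crossProduct a b) = -b := by
  simp only [dotProduct, Fin.sum_univ_three] at haa hab
  ext i
  fin_cases i
  · simp [cross_apply]
    linear_combination a 0 * hab - b 0 * haa
  · simp [cross_apply]
    linear_combination a 1 * hab - b 1 * haa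
  · simp [cross_apply]
    linear_combination a 2 * hab - b 2 * haa

theorem sphCurve_dotProduct_deriv {J : Set ℝ} (hJ : IsOpen J) {r : ℝ → Fin 3 → ℝ}
    (hr : DifferentiableOn ℝ r J) (hrs : ∀ v ∈ J, r v ⬝ᵥ r v = 1) {v : ℝ} (hv : v ∈ J) :
    r v ⬝ᵥ deriv r v = 0 := by
  have hd := (hr.differentiableAt (hJ.mem_nhds hv)).hasDerivAt
  have h1 := hasDerivAt_dotProduct hd hd
  have h2 : HasDerivAt (fun s => r s ⬝ᵥ r s) 0 v :=
    (hasDerivAt_const v (1 : ℝ)).congr_of_eventuallyEq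
      (Filter.eventually_of_mem (hJ.mem_nhds hv) hrs)
  have h3 := h1.unique h2
  rw [dotProduct_comm (deriv r v)] at h3
  linarith

/-- The Frenet formula `t' = κ n − r` for a unit-speed spherical curve. -/
theorem hasDerivAt_sphT {J : Set ℝ} (hJ : IsOpen J) {r : ℝ → Fin 3 → ℝ}
    (hr : ContDiffOn ℝ 2 r J) (hrs : ∀ v ∈ J, r v ⬝ᵥ r v = 1)
    (hra : ∀ v ∈ J, deriv r v ⬝ᵥ deriv r v = 1) {v : ℝ} (hv : v ∈ J) :
    HasDerivAt (deriv r) (sphCurv r v • sphN r v - r v) v := by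
  have hdr := hr.differentiableOn two_ne_zero
  have hdt : DifferentiableOn ℝ (deriv r) J :=
    (hr.deriv_of_isOpen (m := 1) hJ (by norm_num)).differentiableOn one_ne_zero
  have hd := (hdr.differentiableAt (hJ.mem_nhds hv)).hasDerivAt
  have ht := (hdt.differentiableAt (hJ.mem_nhds hv)).hasDerivAt
  have hort : ∀ s ∈ J, r s ⬝ᵥ deriv r s = 0 := fun s => sphCurve_dotProduct_deriv hJ hdr hrs
  have htt := sphCurve_dotProduct_deriv hJ hdt hra hv
  have h1 := hasDerivAt_dotProduct hd ht
  have h2 : HasDerivAt (fun s => r s ⬝ᵥ deriv r s) 0 v :=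
    (hasDerivAt_const v (0 : ℝ)).congr_of_eventuallyEq
      (Filter.eventually_of_mem (hJ.mem_nhds hv) hort)
  have h3 := h1.unique h2
  rw [hra v hv] at h3
  refine ht.congr_deriv ?_
  rw [eq_sum_dotProduct_smul_of_orthonormal (w := deriv (deriv r) v) (hrs v hv) (hra v hv)
    (hort v hv), dotProduct_comm _ (r v), dotProduct_comm _ (deriv r v), htt,
    show r v ⬝ᵥ deriv (deriv r) v = -1 by linarith, sphCurv, sphN]
  module

/-- The Frenet formula `n' = −κ t` for a unit-speed spherical curve. -/
theorem hasDerivAt_sphN {J : Set ℝ} (hJ : IsOpen J) {r : ℝ → Fin 3 → ℝ}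
    (hr : ContDiffOn ℝ 2 r J) (hrs : ∀ v ∈ J, r v ⬝ᵥ r v = 1)
    (hra : ∀ v ∈ J, deriv r v ⬝ᵥ deriv r v = 1) {v : ℝ} (hv : v ∈ J) :
    HasDerivAt (sphN r) (-(sphCurv r v) • deriv r v) v := by
  have hdr := hr.differentiableOn two_ne_zero
  have hd := (hdr.differentiableAt (hJ.mem_nhds hv)).hasDerivAt
  refine (hasDerivAt_crossProduct hd (hasDerivAt_sphT hJ hr hrs hra hv)).congr_deriv ?_
  rw [cross_self, map_sub, map_smul, cross_self, sphN,
    cross_frenet (hrs v hv) (sphCurve_dotProduct_deriv hJ hdr hrs hv)]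
  module

theorem emb_sub (a b : Fin 3 → ℝ) : emb (a - b) = emb a - emb b := by
  ext i; fin_cases i <;> simp [emb]

theorem emb_smul (c : ℝ) (a : Fin 3 → ℝ) : emb (c • a) = c • emb a := by
  ext i; fin_cases i <;> simp [emb]

theorem emb_dotProduct_emb (a b : Fin 3 → ℝ) : emb a ⬝ᵥ emb b = a ⬝ᵥ b := by
  simp [emb, dotProduct, Fin.sum_univ_three, Fin.sum_univ_four]

theorem wedge_contract (a b c d : Fin 4 → ℝ) :
    (c ᵥ* Matrix.of (wedge a b)) ⬝ᵥ d = (a ⬝ᵥ c) * (b ⬝ᵥ d) - (a ⬝ᵥ d) * (b ⬝ᵥ c) := by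
  simp [wedge, vecMul, dotProduct, Fin.sum_univ_four]
  ring

/-- If `g ≡ b`, `f(u) = εu + a` with `ε = ±1`, and `κ ≡ κ₀ ≠ 0`, then
`ΔG = ((κ₀² + 1)/f²)(G + C)` with `C = −(1/(κ₀²+1)) x∧y − (κ₀ε/(κ₀²+1)) y∧n₁` a nonzero
bivector constant in `(u,v)`; in particular `M²` has proper pointwise 1-type Gauss map of
the second kind. -/
theorem meridian_surface_second_kind_example_g_const
    (I J : Set ℝ) (hI : IsOpen I) (hIiv : I.OrdConnected) (hIne : I.Nonempty)
    (hJ : IsOpen J) (hJiv : J.OrdConnected) (hJne : J.Nonempty)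
    (r : ℝ → Fin 3 → ℝ) (hr : ContDiffOn ℝ (⊤ : ℕ∞) r J)
    (hrs : ∀ v ∈ J, r v ⬝ᵥ r v = 1) (hra : ∀ v ∈ J, deriv r v ⬝ᵥ deriv r v = 1)
    (f g : ℝ → ℝ) (hf : ContDiffOn ℝ (⊤ : ℕ∞) f I) (hg : ContDiffOn ℝ (⊤ : ℕ∞) g I)
    (hf0 : ∀ u ∈ I, f u ≠ 0) (hfg : ∀ u ∈ I, deriv f u ^ 2 + deriv g u ^ 2 = 1)
    (ε a b κ₀ : ℝ) (hε : ε = 1 ∨ ε = -1)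
    (hfu : ∀ u ∈ I, f u = ε * u + a) (hgu : ∀ u ∈ I, g u = b)
    (hκ : ∀ v ∈ J, sphCurv r v = κ₀) (hκ0 : κ₀ ≠ 0) :
    (∀ u ∈ I, ∀ v ∈ J,
        surfLap f (gaussG f g r) u v
          = ((κ₀ ^ 2 + 1) / f u ^ 2) • (gaussG f g r u v + C11 f g r κ₀ ε u v)) ∧
    (∀ u ∈ I, ∀ v ∈ J, ∀ u' ∈ I, ∀ v' ∈ J, C11 f g r κ₀ ε u v = C11 f g r κ₀ ε u' v') ∧
    (∀ u ∈ I, ∀ v ∈ J, C11 f g r κ₀ ε u v ≠ 0) ∧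
    (∃ (lam : ℝ → ℝ → ℝ) (C : Fin 4 → Fin 4 → ℝ),
        ContDiffOn ℝ (⊤ : ℕ∞) (Function.uncurry lam) (I ×ˢ J) ∧
        (∀ u ∈ I, ∀ v ∈ J, lam u v ≠ 0) ∧
        (¬ ∀ u ∈ I, ∀ v ∈ J, ∀ u' ∈ I, ∀ v' ∈ J, lam u v = lam u' v') ∧
        (∀ i j, C i j = -C j i) ∧ C ≠ 0 ∧
        ∀ u ∈ I, ∀ v ∈ J, surfLap f (gaussG f g r) u v = lam u v • (gaussG f g r u v + C)) := by
  have hr2 : ContDiffOn ℝ 2 r J := contDiffOn_infty.mp hr 2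
  have hdr := hr2.differentiableOn two_ne_zero
  have hrd : ∀ v ∈ J, HasDerivAt (fun s => emb (r s)) (emb (deriv r v)) v := fun v hv =>
    hasDerivAt_emb (hdr.differentiableAt (hJ.mem_nhds hv)).hasDerivAt
  have htd : ∀ v ∈ J, HasDerivAt (fun s => emb (deriv r s))
      (κ₀ • emb (sphN r v) - emb (r v)) v := fun v hv => by
    have h := hasDerivAt_emb (hasDerivAt_sphT hJ hr2 hrs hra hv)
    rwa [hκ v hv, emb_sub, emb_smul] at h
  have hnd : ∀ v ∈ J, HasDerivAt (fun s => emb (sphN r s)) (-κ₀ • emb (deriv r v)) v :=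
    fun v hv => by
      have h := hasDerivAt_emb (hasDerivAt_sphN hJ hr2 hrs hra hv)
      rwa [hκ v hv, emb_smul] at h
  have hf' : ∀ u ∈ I, deriv f u = ε := fun u hu => by
    have h : f =ᶠ[nhds u] fun s => ε * s + a := Filter.eventually_of_mem (hI.mem_nhds hu) hfu
    simp [h.deriv_eq]
  have hg' : ∀ u ∈ I, deriv g u = 0 := fun u hu => by
    have h : g =ᶠ[nhds u] fun _ => b := Filter.eventually_of_mem (hI.mem_nhds hu) hgu
    rw [h.deriv_eq, deriv_const]
  have hε0 : ε ≠ 0 := by rcases hε with h | h <;> rw [h] <;> norm_num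
  have hx : ∀ u ∈ I, ∀ v, mx f g r u v = ε • emb (r v) := fun u hu v => by
    rw [mx, hf' u hu, hg' u hu, zero_smul, add_zero]
  have hG : ∀ u ∈ I, ∀ v, gaussG f g r u v = ε • wedge (emb (r v)) (emb (deriv r v)) :=
    fun u hu v => by
      rw [gaussG, hx u hu, my]
      ext i j
      simp only [wedge, Pi.smul_apply, smul_eq_mul]
      ring
  have hC : ∀ u ∈ I, ∀ v, C11 f g r κ₀ ε u v = (-(ε / (κ₀ ^ 2 + 1))) •
      (wedge (emb (r v)) (emb (deriv r v)) + κ₀ • wedge (emb (deriv r v)) (emb (sphN r v))) :=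
    fun u hu v => by
      rw [C11, hx u hu, my, mn1]
      ext i j
      simp only [wedge, Pi.smul_apply, Pi.add_apply, smul_eq_mul]
      ring
  have hrtd : ∀ v ∈ J, HasDerivAt (fun s => wedge (emb (r s)) (emb (deriv r s)))
      (κ₀ • wedge (emb (r v)) (emb (sphN r v))) v := fun v hv => by
    refine (hasDerivAt_wedge (hrd v hv) (htd v hv)).congr_deriv ?_
    ext i j
    simp only [wedge, Pi.smul_apply, Pi.add_apply, Pi.sub_apply, smul_eq_mul]
    ring
  have hrnd : ∀ v ∈ J, HasDerivAt (fun s => wedge (emb (r s)) (emb (sphN r s)))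
      (wedge (emb (deriv r v)) (emb (sphN r v)) - κ₀ • wedge (emb (r v)) (emb (deriv r v))) v :=
    fun v hv => by
      refine (hasDerivAt_wedge (hrd v hv) (hnd v hv)).congr_deriv ?_
      ext i j
      simp only [wedge, Pi.smul_apply, Pi.add_apply, Pi.sub_apply, smul_eq_mul]
      ring
  have htnd : ∀ v ∈ J, HasDerivAt (fun s => wedge (emb (deriv r s)) (emb (sphN r s)))
      (-wedge (emb (r v)) (emb (sphN r v))) v := fun v hv => by
    refine (hasDerivAt_wedge (htd v hv) (hnd v hv)).congr_deriv ?_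
    ext i j
    simp only [wedge, Pi.smul_apply, Pi.add_apply, Pi.sub_apply, Pi.neg_apply, smul_eq_mul]
    ring
  have hlap : ∀ u ∈ I, ∀ v ∈ J, surfLap f (gaussG f g r) u v
      = ((κ₀ ^ 2 + 1) / f u ^ 2) • (gaussG f g r u v + C11 f g r κ₀ ε u v) := by
    intro u hu v hv
    have hu1 : ∀ s ∈ I, deriv (fun s => gaussG f g r s v) s = 0 := fun s hs => by
      have h : (fun s => gaussG f g r s v) =ᶠ[nhds s]
          fun _ => ε • wedge (emb (r v)) (emb (deriv r v)) :=
        Filter.eventually_of_mem (hI.mem_nhds hs) fun w hw => hG w hw v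
      rw [h.deriv_eq, deriv_const]
    have hu2 : deriv (deriv fun s => gaussG f g r s v) u = 0 := by
      have h : (deriv fun s => gaussG f g r s v) =ᶠ[nhds u] fun _ => 0 :=
        Filter.eventually_of_mem (hI.mem_nhds hu) hu1
      rw [h.deriv_eq, deriv_const]
    have hv1 : ∀ s ∈ J, deriv (fun s => gaussG f g r u s) s
        = ε • κ₀ • wedge (emb (r s)) (emb (sphN r s)) := fun s hs => by
      rw [funext (hG u hu)]
      exact ((hrtd s hs).const_smul ε).deriv
    have hv2 : deriv (deriv fun s => gaussG f g r u s) v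
        = ε • κ₀ • (wedge (emb (deriv r v)) (emb (sphN r v))
          - κ₀ • wedge (emb (r v)) (emb (deriv r v))) := by
      have h : (deriv fun s => gaussG f g r u s) =ᶠ[nhds v]
          fun s => ε • κ₀ • wedge (emb (r s)) (emb (sphN r s)) :=
        Filter.eventually_of_mem (hJ.mem_nhds hv) hv1
      rw [h.deriv_eq]
      exact (((hrnd v hv).const_smul κ₀).const_smul ε).deriv
    have hf0u := hf0 u hu
    have hκp : κ₀ ^ 2 + 1 ≠ 0 := by positivity
    rw [surfLap, hu2, hv2, hu1 u hu, hG u hu, hC u hu]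
    ext i j
    simp only [Pi.smul_apply, Pi.add_apply, Pi.sub_apply, Pi.neg_apply, Pi.zero_apply,
      smul_eq_mul]
    field_simp
    ring
  have hconst : ∀ u ∈ I, ∀ v ∈ J, ∀ u' ∈ I, ∀ v' ∈ J,
      C11 f g r κ₀ ε u v = C11 f g r κ₀ ε u' v' := by
    intro u hu v hv u' hu' v' hv'
    rw [hC u hu, hC u' hu']
    congr 1
    have hd : ∀ s ∈ J, HasDerivAt (fun v => wedge (emb (r v)) (emb (deriv r v))
        + κ₀ • wedge (emb (deriv r v)) (emb (sphN r v))) 0 s := fun s hs =>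
      ((hrtd s hs).add ((htnd s hs).const_smul κ₀)).congr_deriv (by module)
    exact hJ.is_const_of_deriv_eq_zero hJiv.isPreconnected
      (fun s hs => (hd s hs).differentiableAt.differentiableWithinAt)
      (fun s hs => (hd s hs).deriv) hv hv'
  have hne : ∀ u ∈ I, ∀ v ∈ J, C11 f g r κ₀ ε u v ≠ 0 := by
    intro u hu v hv h
    rw [hC u hu, smul_eq_zero] at h
    rcases h with h | h
    · have hκp : κ₀ ^ 2 + 1 ≠ 0 := by positivity
      exact div_ne_zero hε0 hκp (neg_eq_zero.mp h)
    · have hrt := sphCurve_dotProduct_deriv hJ hdr hrs hv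
      have hrn : r v ⬝ᵥ sphN r v = 0 := dot_self_cross _ _
      have htn : deriv r v ⬝ᵥ sphN r v = 0 := dot_cross_self _ _
      have h1 : (emb (r v) ᵥ* Matrix.of (wedge (emb (r v)) (emb (deriv r v))
          + κ₀ • wedge (emb (deriv r v)) (emb (sphN r v)))) ⬝ᵥ emb (deriv r v) = 0 := by
        rw [h]; simp
      rw [← Matrix.of_add_of, ← Matrix.smul_of, vecMul_add, vecMul_smul, add_dotProduct,
        smul_dotProduct, wedge_contract, wedge_contract] at h1
      simp only [emb_dotProduct_emb, dotProduct_comm (deriv r v) (r v),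
        dotProduct_comm (sphN r v), hrt, hrn, htn, hrs v hv, hra v hv] at h1
      norm_num at h1
  refine ⟨hlap, hconst, hne, ?_⟩
  obtain ⟨u₀, hu₀⟩ := hIne
  obtain ⟨v₀, hv₀⟩ := hJne
  refine ⟨fun u _ => (κ₀ ^ 2 + 1) / f u ^ 2, C11 f g r κ₀ ε u₀ v₀, ?_, ?_, ?_, ?_,
    hne u₀ hu₀ v₀ hv₀, ?_⟩
  · have hfst : ContDiffOn ℝ (⊤ : ℕ∞) (fun p : ℝ × ℝ => f p.1) (I ×ˢ J) :=
      hf.comp contDiff_fst.contDiffOn fun p hp => hp.1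
    exact contDiffOn_const.div (hfst.pow 2) fun p hp => pow_ne_zero 2 (hf0 p.1 hp.1)
  · intro u hu v _
    have := hf0 u hu
    positivity
  · intro hlam
    have hsq : ∀ u ∈ I, f u ^ 2 = f u₀ ^ 2 := fun u hu => by
      have h := hlam u hu v₀ hv₀ u₀ hu₀ v₀ hv₀
      have hκp : κ₀ ^ 2 + 1 ≠ 0 := by positivity
      have hfu0 := hf0 u hu
      have hfu₀ := hf0 u₀ hu₀
      field_simp at h
      exact h.symm
    have hfd : HasDerivAt f ε u₀ := by
      rw [← hf' u₀ hu₀]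
      exact ((hf.differentiableOn (by simp)).differentiableAt (hI.mem_nhds hu₀)).hasDerivAt
    have h2 : HasDerivAt (fun s => f s ^ 2) 0 u₀ :=
      (hasDerivAt_const u₀ (f u₀ ^ 2)).congr_of_eventuallyEq
        (Filter.eventually_of_mem (hI.mem_nhds hu₀) hsq)
    have h3 := (hfd.fun_pow 2).unique h2
    have := hf0 u₀ hu₀
    simp [hε0, this] at h3
  · intro i j
    simp only [C11, wedge, Pi.smul_apply, Pi.add_apply, smul_eq_mul]
    ring
  · intro u hu v hv
    rw [hlap u hu v hv, hconst u hu v hv u₀ hu₀ v₀ hv₀]
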